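/- Let C be an [n,k] code and C̄ an [n,k̄] code over a finite field F, and let C̃ = C ∘ C̄ be their Hadamard product, of dimension k̃. Suppose there exist k information sets Ĩ_1,…,Ĩ_k of C̃, an information set I = {j_1,…,j_k} of C, and n−k̃ distinct automorphisms π_1,…,π_{n−k̃} of C such that for every i ∈ {1,…,k}, Ĩ_i ∪ {π_1(j_i),…,π_{n−k̃}(j_i)} = {1,…,n}. Then there exist k information sets of C̃ and n−k̃ information sets of C such that every coordinate j ∈ {1,…,n} belongs to exactly k sets of the combined collection (counted with multiplicity); i.e., a PIR maximum rate matrix Λ̃_{k,k+n−k̃} exists for (C,C̄). -/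

import Mathlib

open scoped Classical

/-- `I` is an information set of the linear code `C ⊆ F^X`: it has size `dim C` and the
restriction map `C → F^I`, `c ↦ c|_I`, is injective. -/
def IsInformationSet {X F : Type*} [Fintype X] [Field F]
    (C : Submodule F (X → F)) (I : Finset X) : Prop :=
  I.card = Module.finrank F C ∧
    ∀ x y : C, (∀ i ∈ I, (x : X → F) i = (y : X → F) i) → x = y

/-- The Hadamard product `C ∘ D` of two subspaces of `F^X`: the span of all componentwise
products of an element of `C` and an element of `D`. -/
def hadamardCode {X F : Type*} [Fintype X] [Field F]
    (C D : Submodule F (X → F)) : Submodule F (X → F) :=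
  Submodule.span F {z | ∃ x ∈ C, ∃ y ∈ D, z = fun j => x j * y j}

/-- `π` is an automorphism of the code `C`: the induced coordinate permutation
`(x_1,…,x_n) ↦ (x_{π(1)},…,x_{π(n)})` maps `C` onto `C`. -/
def IsCodeAut {n : ℕ} {F : Type*} [Field F] (C : Submodule F (Fin n → F))
    (π : Equiv.Perm (Fin n)) : Prop :=
  ∀ x : Fin n → F, x ∈ C ↔ (fun i => x (π i)) ∈ C

/-- An automorphism of a code maps information sets to information sets. -/
lemma IsInformationSet.map_codeAut {n : ℕ} {F : Type*} [Field F]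
    {C : Submodule F (Fin n → F)} {I : Finset (Fin n)} (hI : IsInformationSet C I)
    {π : Equiv.Perm (Fin n)} (hπ : IsCodeAut C π) :
    IsInformationSet C (I.map π.toEmbedding) := by
  refine ⟨by rw [Finset.card_map, hI.1], fun x y hxy => ?_⟩
  have h := hI.2 ⟨_, (hπ x).1 x.2⟩ ⟨_, (hπ y).1 y.2⟩
    fun i hi => hxy (π i) (Finset.mem_map_of_mem _ hi)
  ext i
  simpa using congrFun (congrArg Subtype.val h) (π.symm i)

/-- If a finset and a family of points indexed by a type of complementary size cover everything,
then every point is covered exactly once. -/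
lemma card_fiber_add_of_union_image_eq_univ {α ι : Type*} [Fintype α] [DecidableEq α]
    [Fintype ι] {S : Finset α} {f : ι → α}
    (hcard : Fintype.card ι = Fintype.card α - S.card)
    (hcover : S ∪ Finset.univ.image f = Finset.univ) (x : α) :
    (if x ∈ S then 1 else 0) + (Finset.univ.filter fun t => f t = x).card = 1 := by
  have hunion := Finset.card_union_add_card_inter S (Finset.univ.image f)
  rw [hcover, Finset.card_univ] at hunion
  have himage : (Finset.univ.image f).card ≤ Fintype.card ι := Finset.card_image_le
  have hS := S.card_le_univ
  have hdisj : S ∩ Finset.univ.image f = ∅ := Finset.card_eq_zero.1 (by omega)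
  have hinj : Function.Injective f := by
    rw [← Set.injOn_univ, ← Finset.coe_univ]
    exact Finset.card_image_iff.1 (by rw [Finset.card_univ]; omega)
  by_cases hx : x ∈ S
  · have hfib : (Finset.univ.filter fun t => f t = x) = ∅ := by
      refine Finset.filter_eq_empty_iff.2 fun t _ ht => ?_
      have hmem : x ∈ S ∩ Finset.univ.image f :=
        Finset.mem_inter.2 ⟨hx, Finset.mem_image.2 ⟨t, Finset.mem_univ t, ht⟩⟩
      simp [hdisj] at hmem
    rw [if_pos hx, hfib, Finset.card_empty]
  · have hmem : x ∈ S ∪ Finset.univ.image f := hcover ▸ Finset.mem_univ x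
    obtain ⟨t, -, rfl⟩ := Finset.mem_image.1 ((Finset.mem_union.1 hmem).resolve_left hx)
    rw [if_neg hx, zero_add, Finset.card_eq_one]
    exact ⟨t, by ext u; simp [hinj.eq_iff]⟩

/-- Let `C` be an `[n,k]` code, `C̄` an `[n,k̄]` code and `C̃ = C ∘ C̄` of
dimension `k̃`.  Suppose there are `k` information sets `Ĩ_1,…,Ĩ_k` of `C̃`, an information set
`I = {j_1,…,j_k}` of `C` (enumerated by an injective `j : Fin k → Fin n`), and `n−k̃` distinct
automorphisms `π_1,…,π_{n−k̃}` of `C` such that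
`Ĩ_i ∪ {π_1(j_i),…,π_{n−k̃}(j_i)} = {1,…,n}` for every `i`.  Then there exist `k` information
sets of `C̃` and `n−k̃` information sets of `C` such that every coordinate belongs to exactly
`k` sets of the combined collection (with multiplicity): a PIR maximum rate matrix
`Λ̃_{k,k+n−k̃}` exists for `(C,C̄)`. -/
theorem pir_max_rate_matrix_sufficient {F : Type*} [Field F] [Fintype F] {n k kbar ktil : ℕ}
    (C Cbar : Submodule F (Fin n → F))
    (hk : Module.finrank F C = k) (hkbar : Module.finrank F Cbar = kbar)
    (hktil : Module.finrank F (hadamardCode C Cbar) = ktil)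
    (Itil : Fin k → Finset (Fin n))
    (hItil : ∀ i, IsInformationSet (hadamardCode C Cbar) (Itil i))
    (I : Finset (Fin n)) (hI : IsInformationSet C I)
    (j : Fin k → Fin n) (hj : Function.Injective j) (hjI : I = Finset.image j Finset.univ)
    (π : Fin (n - ktil) → Equiv.Perm (Fin n)) (hπdist : Function.Injective π)
    (hπaut : ∀ t, IsCodeAut C (π t))
    (hcover : ∀ i : Fin k,
      Itil i ∪ Finset.image (fun t : Fin (n - ktil) => π t (j i)) Finset.univ =
        Finset.univ) :
    ∃ Itil' : Fin k → Finset (Fin n), ∃ I' : Fin (n - ktil) → Finset (Fin n),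
      (∀ i, IsInformationSet (hadamardCode C Cbar) (Itil' i)) ∧
      (∀ t, IsInformationSet C (I' t)) ∧
      ∀ x : Fin n,
        (Finset.univ.filter fun i : Fin k => x ∈ Itil' i).card +
          (Finset.univ.filter fun t : Fin (n - ktil) => x ∈ I' t).card = k := by
  refine ⟨Itil, fun t => I.map (π t).toEmbedding, hItil, fun t => hI.map_codeAut (hπaut t),
    fun x => ?_⟩
  have hpoint (i : Fin k) := card_fiber_add_of_union_image_eq_univ
    (by rw [(hItil i).1, hktil, Fintype.card_fin, Fintype.card_fin]) (hcover i) x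
  have hmem (t : Fin (n - ktil)) : (if x ∈ I.map (π t).toEmbedding then 1 else 0) =
      ∑ i, if π t (j i) = x then 1 else 0 := by
    by_cases hx : ∃ i, π t (j i) = x
    · obtain ⟨i, rfl⟩ := hx
      rw [if_pos (by simp [hjI])]
      simp [hj.eq_iff]
    · rw [if_neg (by simpa [hjI, Equiv.eq_symm_apply] using hx)]
      push Not at hx
      simp [hx]
  calc _ = ∑ i, ((if x ∈ Itil i then 1 else 0) +
        (Finset.univ.filter fun t => π t (j i) = x).card) := by
        simp_rw [Finset.card_filter, hmem]
        rw [Finset.sum_comm, Finset.sum_add_distrib]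
    _ = k := by simp [hpoint]
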